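/- Let F and F' be non-abelian free groups. If Aut(F) ≅ Aut(F'), then F ≅ F'. -/

import Mathlib

open Cardinal

namespace Module.End

/-- A commuting family of distinct linear involutions of an `n`-dimensional rational vector space
has at most `2 ^ n` members. -/
theorem finite_and_card_le_of_commute_involutions {ι V : Type*} [AddCommGroup V] [Module ℚ V]
    [FiniteDimensional ℚ V] (f : ι → Module.End ℚ V) (hcomm : ∀ i j, Commute (f i) (f j))
    (hsq : ∀ i, f i * f i = 1) (hinj : Function.Injective f) :
    Finite ι ∧ Nat.card ι ≤ 2 ^ Module.finrank ℚ V := by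
  classical
  have hsq' (i : ι) (v : V) : f i (f i v) = v := by
    rw [← Module.End.mul_apply, hsq, Module.End.one_apply]
  have hss (i : ι) : (f i).IsSemisimple := by
    refine isSemisimple_of_squarefree_aeval_eq_zero (p := Polynomial.X ^ 2 - Polynomial.C 1)
      (Polynomial.separable_X_pow_sub_C 1 (by norm_num) one_ne_zero).squarefree ?_
    simp [pow_two, hsq]
  have heig (i : ι) (μ : ℚ) : (f i).maxGenEigenspace μ = (f i).eigenspace μ :=
    (isFinitelySemisimple_iff_isSemisimple.mpr (hss i)).maxGenEigenspace_eq_eigenspace μ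
  have htop (i : ι) : ⨆ μ, (f i).maxGenEigenspace μ = ⊤ := by
    rw [eq_top_iff]
    intro v _
    have hv : v = (2⁻¹ : ℚ) • (v + f i v) + (2⁻¹ : ℚ) • (v - f i v) := by module
    rw [hv]
    refine add_mem (Submodule.smul_mem _ _ ?_) (Submodule.smul_mem _ _ ?_)
    · refine Submodule.mem_iSup_of_mem 1 ?_
      rw [heig, mem_eigenspace_iff, map_add, hsq']
      module
    · refine Submodule.mem_iSup_of_mem (-1) ?_
      rw [heig, mem_eigenspace_iff, map_sub, hsq']
      module
  have hspan := iSup_iInf_maxGenEigenspace_eq_top_of_iSup_maxGenEigenspace_eq_top_of_commute f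
    (fun i j _ => hcomm i j) htop
  have hind := independent_iInf_maxGenEigenspace_of_forall_mapsTo f
    (fun i j μ => mapsTo_maxGenEigenspace_of_comm (hcomm j i) μ)
  have hmem {χ : ι → ℚ} {v : V} (hv : v ∈ ⨅ i, (f i).maxGenEigenspace (χ i)) (i : ι) :
      f i v = χ i • v := by
    rw [Submodule.mem_iInf] at hv
    rw [← mem_eigenspace_iff, ← heig]
    exact hv i
  let S := {χ : ι → ℚ // (⨅ i, (f i).maxGenEigenspace (χ i)) ≠ ⊥}
  have : Fintype S := hind.fintypeNeBotOfFiniteDimensional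
  have hS : Fintype.card S ≤ Module.finrank ℚ V := hind.subtype_ne_bot_le_finrank
  have hval (χ : S) (i : ι) : χ.1 i = 1 ∨ χ.1 i = -1 := by
    obtain ⟨v, hv, hv0⟩ := Submodule.exists_mem_ne_zero_of_ne_bot χ.2
    have h := hsq' i v
    rw [hmem hv, map_smul, hmem hv, smul_smul] at h
    refine mul_self_eq_one_iff.mp (smul_left_injective ℚ hv0 ?_)
    simpa using h
  let g : ι → S → Bool := fun i χ => decide (χ.1 i = 1)
  have hg : Function.Injective g := by
    intro i j hij
    have hχ (χ : S) : χ.1 i = χ.1 j := by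
      have h : χ.1 i = 1 ↔ χ.1 j = 1 := by simpa [g] using congrFun hij χ
      rcases hval χ i with hi | hi <;> rcases hval χ j with hj | hj <;>
        simp only [hi, hj] at h ⊢ <;> norm_num at h
    refine hinj (LinearMap.ext fun v => ?_)
    have hv : v ∈ ⨆ χ : ι → ℚ, ⨅ i, (f i).maxGenEigenspace (χ i) := hspan ▸ Submodule.mem_top
    induction hv using Submodule.iSup_induction' with
    | mem χ v hv =>
      by_cases hbot : (⨅ i, (f i).maxGenEigenspace (χ i)) = ⊥
      · rw [hbot, Submodule.mem_bot] at hv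
        simp [hv]
      · rw [hmem hv, hmem hv, show χ i = χ j from hχ ⟨χ, hbot⟩]
    | zero => simp
    | add v w _ _ hv hw => simp [hv, hw]
  refine ⟨_root_.Finite.of_injective g hg, (Nat.card_le_card_of_injective g hg).trans ?_⟩
  rw [Nat.card_eq_fintype_card, Fintype.card_fun, Fintype.card_bool]
  exact Nat.pow_le_pow_right two_pos hS

end Module.End

section PolynomialFunctions

variable {G : Type*} [Group G]

/-- The difference operator `f ↦ (x ↦ f (h * x) - f x)`. -/
def leftDiff (h : G) : (G → ℚ) →ₗ[ℚ] (G → ℚ) where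
  toFun f x := f (h * x) - f x
  map_add' f g := by ext x; simp; ring
  map_smul' c f := by ext x; simp; ring

@[simp]
theorem leftDiff_apply (h : G) (f : G → ℚ) (x : G) : leftDiff h f x = f (h * x) - f x := rfl

variable (G) in
/-- Rational-valued functions on a group killed by any `k` successive difference operators. -/
def polyFun : ℕ → Submodule ℚ (G → ℚ)
  | 0 => ⊥
  | k + 1 => ⨅ h : G, (polyFun k).comap (leftDiff h)

theorem mem_polyFun_succ {k : ℕ} {f : G → ℚ} :
    f ∈ polyFun G (k + 1) ↔ ∀ h, leftDiff h f ∈ polyFun G k := by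
  simp [polyFun]

theorem translate_mem_polyFun {k : ℕ} {f : G → ℚ} (hf : f ∈ polyFun G k) (u : G) :
    (fun x => f (u * x)) ∈ polyFun G k := by
  induction k generalizing f with
  | zero =>
    rw [polyFun, Submodule.mem_bot] at hf ⊢
    subst hf
    rfl
  | succ k ih =>
    rw [mem_polyFun_succ] at hf ⊢
    intro h
    convert ih (hf (u * h * u⁻¹)) using 1
    ext x
    simp [mul_assoc]

theorem const_mem_polyFun_one (c : ℚ) : (fun _ => c) ∈ polyFun G 1 := by
  rw [mem_polyFun_succ]
  intro h
  rw [polyFun, Submodule.mem_bot]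
  ext x
  simp

/-- Modulo functions of degree two lower, `h ↦ leftDiff h f` is a homomorphism to a rational
vector space, hence determined by the rational characters of the group. -/
theorem leftDiff_sub_leftDiff_mem {k : ℕ} {f : G → ℚ} (hf : f ∈ polyFun G (k + 2)) {u v : G}
    (huv : ∀ χ : Additive G →+ ℚ, χ (.ofMul u) = χ (.ofMul v)) :
    leftDiff u f - leftDiff v f ∈ polyFun G k := by
  rw [← Submodule.Quotient.mk_eq_zero, ← Module.forall_dual_apply_eq_zero_iff ℚ]
  intro φ
  let χ : Additive G →+ ℚ := AddMonoidHom.mk'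
    (fun a => φ (Submodule.Quotient.mk (leftDiff a.toMul f))) (by
      intro a b
      rw [← map_add, ← Submodule.Quotient.mk_add]
      congr 1
      rw [Submodule.Quotient.eq]
      convert mem_polyFun_succ.mp (mem_polyFun_succ.mp hf a.toMul) b.toMul using 1
      ext x
      simp [mul_assoc]
      ring)
  rw [Submodule.Quotient.mk_sub, map_sub, sub_eq_zero]
  exact huv χ

/-- An involution acting trivially on rational characters fixes all polynomial functions. -/
theorem polyFun_apply_eq_of_involutive (σ : G ≃* G) (hσ : ∀ x, σ (σ x) = x)
    (hχ : ∀ (χ : Additive G →+ ℚ) (u : G), χ (.ofMul (σ u)) = χ (.ofMul u))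
    {k : ℕ} {f : G → ℚ} (hf : f ∈ polyFun G k) (x : G) : f (σ x) = f x := by
  induction k using Nat.strong_induction_on generalizing f x with
  | _ k ih =>
  match k with
  | 0 =>
    rw [polyFun, Submodule.mem_bot] at hf
    simp [hf]
  | 1 =>
    have h (u : G) : f u = f 1 := by
      have := mem_polyFun_succ.mp hf u
      rw [polyFun, Submodule.mem_bot] at this
      simpa [sub_eq_zero] using congrFun this 1
    rw [h, h x]
  | k + 2 =>
    have hg : (fun x => f (σ x) - f x) ∈ polyFun G (k + 1) := by
      rw [mem_polyFun_succ]
      intro h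
      convert leftDiff_sub_leftDiff_mem hf (fun χ => hχ χ h) using 1
      ext x
      have := ih (k + 1) (by lia) (mem_polyFun_succ.mp hf (σ h)) x
      simp only [leftDiff_apply, map_mul, Pi.sub_apply] at this ⊢
      linarith
    have := ih (k + 1) (by lia) hg x
    simp only [hσ] at this
    linarith

end PolynomialFunctions

namespace FreeGroup

variable {X : Type*}

section Magnus

open Classical in
/-- The affine action on pairs whose first coordinate integrates `f` in the direction `y`. -/
noncomputable def integralAction (y : X) (f : FreeGroup X → ℚ) :
    FreeGroup X →* Equiv.Perm (ℚ × FreeGroup X) :=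
  lift fun x =>
    { toFun p := (p.1 + (if x = y then f p.2 else 0), of x * p.2)
      invFun p := (p.1 - (if x = y then f ((of x)⁻¹ * p.2) else 0), (of x)⁻¹ * p.2)
      left_inv p := by simp
      right_inv p := by simp }

/-- The function vanishing at `1` whose difference along the generator `y` is `f` and whose
differences along the other generators vanish. -/
noncomputable def integral (y : X) (f : FreeGroup X → ℚ) (w : FreeGroup X) : ℚ :=
  (integralAction y f w (0, 1)).1

@[simp]
theorem integral_one (y : X) (f : FreeGroup X → ℚ) : integral y f 1 = 0 := by
  simp [integral]

theorem integralAction_snd (y : X) (f : FreeGroup X → ℚ) (w : FreeGroup X)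
    (p : ℚ × FreeGroup X) : (integralAction y f w p).2 = w * p.2 := by
  induction w using FreeGroup.induction_on generalizing p with
  | C1 => simp
  | of x => simp [integralAction]
  | inv_of x _ => simp [integralAction, Equiv.Perm.inv_def]
  | mul u v hu hv => simp [hu, hv, mul_assoc]

open Classical in
theorem integral_of_mul (y x : X) (f : FreeGroup X → ℚ) (w : FreeGroup X) :
    integral y f (of x * w) = integral y f w + if x = y then f w else 0 := by
  have h := integralAction_snd y f w (0, 1)
  rw [mul_one] at h
  have hx (p : ℚ × FreeGroup X) :
      (integralAction y f (of x) p).1 = p.1 + if x = y then f p.2 else 0 := by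
    simp [integralAction]
  rw [integral, _root_.map_mul, Equiv.Perm.mul_apply, hx, h]
  rfl

theorem integral_mem_polyFun (y : X) {k : ℕ} {f : FreeGroup X → ℚ}
    (hf : f ∈ polyFun (FreeGroup X) k) : integral y f ∈ polyFun (FreeGroup X) (k + 1) := by
  classical
  rw [mem_polyFun_succ]
  intro h
  induction h using FreeGroup.induction_on with
  | C1 =>
    convert Submodule.zero_mem _ using 1
    ext x
    simp
  | of x =>
    by_cases hxy : x = y
    · convert hf using 1
      ext w
      simp [integral_of_mul, hxy]
    · convert Submodule.zero_mem _ using 1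
      ext w
      simp [integral_of_mul, hxy]
  | inv_of x hx =>
    convert Submodule.neg_mem _ (translate_mem_polyFun hx (of x)⁻¹) using 1
    ext w
    simp
  | mul u v hu hv =>
    convert add_mem (translate_mem_polyFun hu v) hv using 1
    ext w
    simp [mul_assoc]

/-- The Magnus coefficient of a monomial, as a function on the free group. -/
noncomputable def magnusCoeff : List X → FreeGroup X → ℚ
  | [] => fun _ => 1
  | y :: l => integral y (magnusCoeff l)

theorem magnusCoeff_mem_polyFun (l : List X) :
    magnusCoeff l ∈ polyFun (FreeGroup X) (l.length + 1) := by
  induction l with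
  | nil => exact const_mem_polyFun_one 1
  | cons y l ih => exact integral_mem_polyFun y ih

theorem magnusCoeff_zpow_mul_of_head_ne {l : List X} {x : X} (h : ∀ y ∈ l.head?, x ≠ y) (m : ℤ)
    (w : FreeGroup X) : magnusCoeff l (of x ^ m * w) = magnusCoeff l w := by
  have hstep (w : FreeGroup X) : magnusCoeff l (of x * w) = magnusCoeff l w := by
    cases l with
    | nil => rfl
    | cons y l => simp [magnusCoeff, integral_of_mul, h y (by simp)]
  induction m with
  | zero => simp
  | succ i ih => rw [add_comm, zpow_add, zpow_one, mul_assoc, hstep, ih]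
  | pred i ih =>
    rw [← hstep, ← mul_assoc, ← zpow_one_add, show (1 + (-(i : ℤ) - 1)) = -(i : ℤ) by ring, ih]

theorem magnusCoeff_cons_zpow_mul {l : List X} {x : X} (h : ∀ y ∈ l.head?, x ≠ y) (m : ℤ)
    (w : FreeGroup X) :
    magnusCoeff (x :: l) (of x ^ m * w) = magnusCoeff (x :: l) w + m * magnusCoeff l w := by
  have hstep (w : FreeGroup X) :
      magnusCoeff (x :: l) (of x * w) = magnusCoeff (x :: l) w + magnusCoeff l w := by
    simp [magnusCoeff, integral_of_mul]
  induction m with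
  | zero => simp
  | succ i ih =>
    rw [add_comm, zpow_add, zpow_one, mul_assoc, hstep, ih, magnusCoeff_zpow_mul_of_head_ne h]
    push_cast
    ring
  | pred i ih =>
    have := hstep (of x ^ (-(i : ℤ) - 1) * w)
    rw [← mul_assoc, ← zpow_one_add, show (1 + (-(i : ℤ) - 1)) = -(i : ℤ) by ring, ih,
      magnusCoeff_zpow_mul_of_head_ne h] at this
    push_cast at this ⊢
    linarith

/-- The product of a list of syllables `x ^ m`. -/
def syllableProd (L : List (X × ℤ)) : FreeGroup X := (L.map fun p => of p.1 ^ p.2).prod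

theorem magnusCoeff_syllableProd_of_length_lt {l : List X} (hl : l.IsChain (· ≠ ·))
    {L : List (X × ℤ)} (h : L.length < l.length) : magnusCoeff l (syllableProd L) = 0 := by
  induction L generalizing l with
  | nil =>
    cases l with
    | nil => simp at h
    | cons y l => simp [magnusCoeff, syllableProd]
  | cons p L ih =>
    cases l with
    | nil => simp at h
    | cons y l =>
      rw [List.isChain_cons] at hl
      simp only [List.length_cons] at h
      have h₁ := ih (l := y :: l) (List.isChain_cons.mpr hl) (by simp; lia)
      have h₂ := ih hl.2 (by lia)
      simp only [syllableProd, List.map_cons, List.prod_cons] at h₁ h₂ ⊢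
      by_cases hy : p.1 = y
      · rw [hy, magnusCoeff_cons_zpow_mul hl.1, h₁, h₂]
        simp
      · rw [magnusCoeff_zpow_mul_of_head_ne (by simpa using hy), h₁]

theorem magnusCoeff_syllableProd {L : List (X × ℤ)}
    (hL : (L.map Prod.fst).IsChain (· ≠ ·)) :
    magnusCoeff (L.map Prod.fst) (syllableProd L) = ((L.map Prod.snd).prod : ℤ) := by
  induction L with
  | nil => simp [magnusCoeff]
  | cons p L ih =>
    have h := magnusCoeff_syllableProd_of_length_lt (L := L) hL (by simp)
    rw [List.map_cons, List.isChain_cons] at hL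
    have ih := ih hL.2
    simp only [syllableProd, List.map_cons, List.prod_cons] at h ih ⊢
    rw [magnusCoeff_cons_zpow_mul hL.1, h, ih]
    push_cast
    ring

theorem exists_eq_syllableProd (w : FreeGroup X) : ∃ L : List (X × ℤ),
    (L.map Prod.fst).IsChain (· ≠ ·) ∧ (∀ p ∈ L, p.2 ≠ 0) ∧ syllableProd L = w := by
  have key (x : X) (e : ℤ) (he : e ≠ 0) (L : List (X × ℤ))
      (hL : (L.map Prod.fst).IsChain (· ≠ ·)) (h0 : ∀ p ∈ L, p.2 ≠ 0) :
      ∃ L' : List (X × ℤ), (L'.map Prod.fst).IsChain (· ≠ ·) ∧ (∀ p ∈ L', p.2 ≠ 0) ∧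
        syllableProd L' = of x ^ e * syllableProd L := by
    rcases L with _ | ⟨⟨y, m⟩, L⟩
    · exact ⟨[(x, e)], by simp, by simpa using he, by simp [syllableProd]⟩
    · by_cases hxy : x = y
      · subst hxy
        by_cases hm : e + m = 0
        · refine ⟨L, (List.isChain_cons.mp hL).2, fun p hp => h0 p (by simp [hp]), ?_⟩
          simp [syllableProd, ← mul_assoc, ← zpow_add, hm]
        · refine ⟨(x, e + m) :: L, hL, ?_, ?_⟩
          · intro p hp
            rcases List.mem_cons.mp hp with rfl | hp
            · exact hm
            · exact h0 p (by simp [hp])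
          · simp [syllableProd, ← mul_assoc, zpow_add]
      · refine ⟨(x, e) :: (y, m) :: L, ?_, ?_, by simp [syllableProd]⟩
        · simp only [List.map_cons, List.isChain_cons_cons] at hL ⊢
          exact ⟨hxy, hL⟩
        · intro p hp
          rcases List.mem_cons.mp hp with rfl | hp
          · exact he
          · exact h0 p hp
  suffices H : ∀ (w : FreeGroup X) (L : List (X × ℤ)), (L.map Prod.fst).IsChain (· ≠ ·) →
      (∀ p ∈ L, p.2 ≠ 0) → ∃ L' : List (X × ℤ), (L'.map Prod.fst).IsChain (· ≠ ·) ∧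
        (∀ p ∈ L', p.2 ≠ 0) ∧ syllableProd L' = w * syllableProd L by
    simpa [syllableProd] using H w [] (by simp) (by simp)
  intro w
  induction w using FreeGroup.induction_on with
  | C1 => exact fun L hL h0 => ⟨L, hL, h0, by simp⟩
  | of x => simpa using key x 1 one_ne_zero
  | inv_of x _ => simpa using key x (-1) (by simp)
  | mul u v hu hv =>
    intro L hL h0
    obtain ⟨L', hL', h0', h'⟩ := hv L hL h0
    obtain ⟨L'', hL'', h0'', h''⟩ := hu L' hL' h0'
    exact ⟨L'', hL'', h0'', by rw [h'', h', mul_assoc]⟩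

/-- Polynomial functions separate the points of a free group from the identity. -/
theorem exists_polyFun_apply_ne {w : FreeGroup X} (hw : w ≠ 1) :
    ∃ k, ∃ f ∈ polyFun (FreeGroup X) k, f w ≠ f 1 := by
  obtain ⟨L, hL, h0, rfl⟩ := exists_eq_syllableProd w
  refine ⟨_, _, magnusCoeff_mem_polyFun (L.map Prod.fst), ?_⟩
  have hne : L ≠ [] := by
    rintro rfl
    exact hw rfl
  have h1 : magnusCoeff (L.map Prod.fst) (1 : FreeGroup X) = 0 :=
    magnusCoeff_syllableProd_of_length_lt (L := []) hL
      (by simpa using List.length_pos_iff.mpr hne)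
  rw [magnusCoeff_syllableProd hL, h1, Int.cast_ne_zero]
  refine List.prod_ne_zero ?_
  simpa using fun x hx => h0 (x, 0) hx rfl

/-- Involutive automorphisms of a free group are detected by the rational abelianization. -/
theorem involution_eq_one_of_char_eq (σ : MulAut (FreeGroup X)) (hσ : σ * σ = 1)
    (hχ : ∀ (χ : Additive (FreeGroup X) →+ ℚ) (u : FreeGroup X),
      χ (.ofMul (σ u)) = χ (.ofMul u)) : σ = 1 := by
  ext1 w
  by_contra hne
  obtain ⟨k, f, hf, hfw⟩ := exists_polyFun_apply_ne (w := w⁻¹ * σ w)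
    (fun h => hne (by simpa using (inv_mul_eq_one.mp h).symm))
  refine hfw ?_
  have := polyFun_apply_eq_of_involutive σ (fun x => DFunLike.congr_fun hσ x) hχ
    (translate_mem_polyFun hf w⁻¹) w
  simpa using this

end Magnus

section FiniteRank

/-- Precomposition of rational characters with an automorphism. -/
def charMap (σ : MulAut (FreeGroup X)) : Module.End ℚ (Additive (FreeGroup X) →+ ℚ) where
  toFun χ := χ.comp (MonoidHom.toAdditive σ.toMonoidHom)
  map_add' _ _ := rfl
  map_smul' _ _ := rfl

@[simp]
theorem charMap_apply (σ : MulAut (FreeGroup X)) (χ : Additive (FreeGroup X) →+ ℚ)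
    (u : FreeGroup X) : charMap σ χ (.ofMul u) = χ (.ofMul (σ u)) := rfl

theorem charMap_mul (σ τ : MulAut (FreeGroup X)) : charMap (σ * τ) = charMap τ * charMap σ := rfl

variable (X) in
/-- A rational character of a free group is determined by its values on the basis. -/
def charEval : (Additive (FreeGroup X) →+ ℚ) →ₗ[ℚ] (X → ℚ) where
  toFun χ x := χ (.ofMul (of x))
  map_add' _ _ := rfl
  map_smul' _ _ := rfl

theorem charEval_injective : Function.Injective (charEval X) := by
  intro χ ψ h
  refine AddMonoidHom.toMultiplicativeRight.injective ?_
  exact FreeGroup.ext_hom _ _ fun x => congrArg Multiplicative.ofAdd (congrFun h x)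

theorem finite_and_card_le_of_injective_mulAut [Finite X] {E : Type*} [CommGroup E]
    (hE : ∀ e : E, e * e = 1) (f : E →* MulAut (FreeGroup X)) (hf : Function.Injective f) :
    Finite E ∧ Nat.card E ≤ 2 ^ Nat.card X := by
  have := Fintype.ofFinite X
  have : FiniteDimensional ℚ (Additive (FreeGroup X) →+ ℚ) :=
    Module.Finite.of_injective _ charEval_injective
  have hdim : Module.finrank ℚ (Additive (FreeGroup X) →+ ℚ) ≤ Nat.card X := by
    simpa using LinearMap.finrank_le_finrank_of_injective (charEval_injective (X := X))
  obtain ⟨h₁, h₂⟩ := Module.End.finite_and_card_le_of_commute_involutions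
    (fun e => charMap (f e))
    (fun a b => by
      rw [Commute, SemiconjBy, ← charMap_mul, ← charMap_mul, ← _root_.map_mul, ← _root_.map_mul, mul_comm])
    (fun a => by rw [← charMap_mul, ← _root_.map_mul, hE, _root_.map_one]; rfl)
    (fun a b hab => by
      have hinv : a⁻¹ = a := inv_eq_of_mul_eq_one_right (hE a)
      have h1 : f (a * b) = 1 := by
        refine involution_eq_one_of_char_eq _ (by rw [← _root_.map_mul, hE, _root_.map_one]) fun χ u => ?_
        have : charMap (f (a * b)) = 1 := by
          rw [_root_.map_mul, charMap_mul]
          simp only at hab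
          rw [hab, ← charMap_mul, ← _root_.map_mul, hE, _root_.map_one]
          rfl
        rw [← charMap_apply, this, Module.End.one_apply]
      have h2 : a * b = 1 := hf (by rw [h1, _root_.map_one])
      rw [← hinv]
      exact inv_eq_of_mul_eq_one_right h2)
  exact ⟨h₁, h₂.trans (Nat.pow_le_pow_right two_pos hdim)⟩

/-- The endomorphism raising each generator to the power given by a choice of signs. -/
def signEnd (s : X → ℤˣ) : FreeGroup X →* FreeGroup X := lift fun x => of x ^ (s x : ℤ)

theorem signEnd_comp (s t : X → ℤˣ) : (signEnd s).comp (signEnd t) = signEnd (s * t) := by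
  ext x
  simp [signEnd, zpow_mul]

theorem signEnd_one : signEnd (1 : X → ℤˣ) = MonoidHom.id _ := by
  ext x
  simp [signEnd]

variable (X) in
/-- The automorphisms inverting some of the generators. -/
def signAut : (X → ℤˣ) →* MulAut (FreeGroup X) where
  toFun s := MonoidHom.toMulEquiv (signEnd s) (signEnd s⁻¹)
    (by rw [signEnd_comp, inv_mul_cancel, signEnd_one])
    (by rw [signEnd_comp, mul_inv_cancel, signEnd_one])
  map_one' := by
    ext1 w
    exact DFunLike.congr_fun signEnd_one w
  map_mul' s t := by
    ext1 w
    exact (DFunLike.congr_fun (signEnd_comp s t) w).symm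

theorem signAut_of (s : X → ℤˣ) (x : X) : signAut X s (of x) = of x ^ (s x : ℤ) := by
  change signEnd s (of x) = _
  simp [signEnd]

theorem signAut_injective : Function.Injective (signAut X) := by
  intro s t h
  ext x
  have := congrArg FreeGroup.sum
    (congrArg (map fun _ => (1 : ℤ)) (DFunLike.congr_fun h (of x)))
  rw [signAut_of, signAut_of] at this
  rcases Int.units_eq_one_or (s x) with hs | hs <;>
    rcases Int.units_eq_one_or (t x) with ht | ht <;> simp [hs, ht] at this ⊢

theorem finite_and_card_le_of_mulAut_equiv {X' : Type*} [Finite X]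
    (e : MulAut (FreeGroup X') ≃* MulAut (FreeGroup X)) :
    Finite X' ∧ Nat.card X' ≤ Nat.card X := by
  classical
  obtain ⟨h₁, h₂⟩ := finite_and_card_le_of_injective_mulAut (X := X) (E := X' → ℤˣ)
    (fun s => by ext x; simp [← pow_two]) (e.toMonoidHom.comp (signAut X'))
    (e.injective.comp signAut_injective)
  have hX' : Finite X' := by
    refine Finite.of_injective (fun x : X' => (Function.update 1 x (-1) : X' → ℤˣ)) ?_
    intro x y hxy
    by_contra hne
    have := congrFun hxy x
    simp [hne] at this
  refine ⟨hX', ?_⟩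
  have := Fintype.ofFinite X'
  rw [Nat.card_fun] at h₂
  exact (Nat.pow_le_pow_iff_right one_lt_two).mp (by simpa using h₂)

end FiniteRank

section InfiniteRank

/-- Nontrivial elements in complementary free factors do not commute. -/
theorem eq_one_of_commute_of_disjoint [DecidableEq X] {c w : FreeGroup X} (h : Commute c w)
    (hdisj : ∀ p ∈ c.toWord, ∀ q ∈ w.toWord, p.1 ≠ q.1) (hw : w ≠ 1) : c = 1 := by
  have hred : (c * w).toWord = c.toWord ++ w.toWord := by
    rw [toWord_mul]
    refine IsReduced.reduce_eq (List.isChain_append.mpr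
      ⟨isReduced_toWord, isReduced_toWord, fun p hp q hq hpq => ?_⟩)
    exact absurd hpq (hdisj p (List.mem_of_getLast? hp) q (List.mem_of_head? hq))
  have hred' : (w * c).toWord = w.toWord ++ c.toWord := by
    rw [toWord_mul]
    refine IsReduced.reduce_eq (List.isChain_append.mpr
      ⟨isReduced_toWord, isReduced_toWord, fun p hp q hq hpq => ?_⟩)
    exact absurd hpq.symm (hdisj q (List.mem_of_head? hq) p (List.mem_of_getLast? hp))
  rw [h.eq, hred'] at hred
  rw [ne_eq, ← toWord_eq_nil_iff] at hw
  rw [← toWord_eq_nil_iff]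
  obtain ⟨q, w', hw'⟩ := List.exists_cons_of_ne_nil hw
  rcases hc : c.toWord with _ | ⟨p, c'⟩
  · rfl
  · rw [hc, hw', List.cons_append, List.cons_append, List.cons.injEq] at hred
    exact absurd (by rw [hred.1]) (hdisj p (by simp [hc]) q (by simp [hw']))

theorem exists_ne_notMem_letters [DecidableEq X] {s : Set X} (hs : s.Infinite)
    (c : FreeGroup X) : ∃ x ∈ s, ∃ y ∈ s, x ≠ y ∧
      ∀ p ∈ c.toWord, p.1 ≠ x ∧ p.1 ≠ y := by
  have hinf : (s \ ((c.toWord.map Prod.fst).toFinset : Set X)).Infinite :=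
    hs.sdiff (Finset.finite_toSet _)
  obtain ⟨x, hx, y, hy, hxy⟩ := hinf.nontrivial
  refine ⟨x, hx.1, y, hy.1, hxy, fun p hp => ⟨?_, ?_⟩⟩
  · rintro rfl
    exact hx.2 (by simpa [-List.mem_map] using List.mem_map_of_mem hp)
  · rintro rfl
    exact hy.2 (by simpa [-List.mem_map] using List.mem_map_of_mem hp)

theorem eq_one_of_commute_inv_mul [DecidableEq X] {c : FreeGroup X} {x y : X} (hxy : x ≠ y)
    (hc : ∀ p ∈ c.toWord, p.1 ≠ x ∧ p.1 ≠ y) (h : Commute c ((of x)⁻¹ * of y)) : c = 1 := by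
  have hw : ((of x)⁻¹ * of y).toWord = [(x, false), (y, true)] := by
    rw [toWord_mul, toWord_inv, toWord_of, toWord_of]
    exact IsReduced.reduce_eq (by simp [IsReduced, invRev, hxy])
  refine eq_one_of_commute_of_disjoint h ?_ ?_
  · rw [hw]
    simpa using fun a b hab => hc (a, b) hab
  · rw [ne_eq, ← toWord_eq_nil_iff, hw]
    simp

theorem conj_injective [Infinite X] :
    Function.Injective (MulAut.conj : FreeGroup X →* MulAut (FreeGroup X)) := by
  classical
  rw [injective_iff_map_eq_one]
  intro c hc
  obtain ⟨x, -, y, -, hxy, h⟩ := exists_ne_notMem_letters (Set.infinite_univ (α := X)) c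
  refine eq_one_of_commute_inv_mul hxy h ?_
  have := DFunLike.congr_fun hc ((of x)⁻¹ * of y)
  rw [MulAut.conj_apply, MulAut.one_apply, mul_inv_eq_iff_eq_mul] at this
  exact this

theorem apply_inv_mul_eq_of_conj_mul_eq [Infinite X] {φ : MulAut (FreeGroup X)}
    {u v : FreeGroup X}
    (h : MulAut.conj u * φ * (MulAut.conj u)⁻¹ = MulAut.conj v * φ * (MulAut.conj v)⁻¹) :
    φ (u⁻¹ * v) = u⁻¹ * v := by
  have hcomm : φ * MulAut.conj (u⁻¹ * v) = MulAut.conj (u⁻¹ * v) * φ := by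
    rw [_root_.map_mul, _root_.map_inv]
    calc φ * ((MulAut.conj u)⁻¹ * MulAut.conj v)
        = (MulAut.conj u)⁻¹ * (MulAut.conj u * φ * (MulAut.conj u)⁻¹) * MulAut.conj v := by group
      _ = _ := by rw [h]; group
  refine conj_injective (MulEquiv.ext fun x => ?_)
  have := DFunLike.congr_fun hcomm (φ⁻¹ x)
  simpa using this

/-- In infinite rank, a nontrivial automorphism has at least as many conjugates as the rank. -/
theorem mk_le_mk_conjugatesOf [Infinite X] {φ : MulAut (FreeGroup X)} (hφ : φ ≠ 1) :
    #X ≤ #(conjugatesOf φ) := by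
  classical
  by_contra! hlt
  obtain ⟨g, hg⟩ : ∃ g, φ g ≠ g := by
    by_contra! h
    exact hφ (MulEquiv.ext h)
  let cls (u : FreeGroup X) : conjugatesOf φ :=
    ⟨MulAut.conj u * φ * (MulAut.conj u)⁻¹, isConj_iff.mpr ⟨_, rfl⟩⟩
  have hlt' : #(conjugatesOf φ × conjugatesOf φ) < #X := by
    rw [← Cardinal.mul_def]
    exact Cardinal.mul_lt_of_lt (aleph0_le_mk X) hlt hlt
  obtain ⟨p, hp⟩ := Cardinal.exists_infinite_fiber
    (fun x : X => (cls (of x), cls (of x * g))) hlt'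
  obtain ⟨x, hx, y, hy, hxy, hc⟩ :=
    exists_ne_notMem_letters (Set.infinite_coe_iff.mp hp) (φ g * g⁻¹)
  have hxy' := (show _ = p from hx).trans (show _ = p from hy).symm
  rw [Prod.mk.injEq] at hxy'
  have h₁ := apply_inv_mul_eq_of_conj_mul_eq (congrArg Subtype.val hxy'.1)
  have h₂ := apply_inv_mul_eq_of_conj_mul_eq (congrArg Subtype.val hxy'.2)
  refine hg (mul_inv_eq_one.mp (eq_one_of_commute_inv_mul hxy hc ?_))
  generalize hw : (of x)⁻¹ * of y = w at h₁
  have hw' : (of x * g)⁻¹ * (of y * g) = g⁻¹ * w * g := by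
    rw [← hw]
    group
  rw [hw', _root_.map_mul, _root_.map_mul, h₁, _root_.map_inv] at h₂
  change φ g * g⁻¹ * w = w * (φ g * g⁻¹)
  calc φ g * g⁻¹ * w = φ g * (g⁻¹ * w * g) * g⁻¹ := by group
    _ = _ := by rw [← h₂]; group

theorem mk_conjugatesOf_conj_le [Infinite X] (u : FreeGroup X) :
    #(conjugatesOf (MulAut.conj u)) ≤ #X := by
  have hsub : conjugatesOf (MulAut.conj u) ⊆ Set.range (MulAut.conj (G := FreeGroup X)) := by
    rintro _ h
    obtain ⟨φ, rfl⟩ := isConj_iff.mp h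
    refine ⟨φ u, MulEquiv.ext fun x => ?_⟩
    simp
  calc #(conjugatesOf (MulAut.conj u)) ≤ #(Set.range (MulAut.conj (G := FreeGroup X))) :=
        Cardinal.mk_le_mk_of_subset hsub
    _ ≤ #(FreeGroup X) := Cardinal.mk_range_le
    _ = #X := by rw [Cardinal.mk_freeGroup, max_eq_left (aleph0_le_mk X)]

theorem lift_mk_le_of_mulAut_equiv.{u, v} {X : Type u} {X' : Type v} [Infinite X] [Infinite X']
    (e : MulAut (FreeGroup X) ≃* MulAut (FreeGroup X')) :
    Cardinal.lift.{u} #X' ≤ Cardinal.lift.{v} #X := by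
  obtain ⟨a⟩ : Nonempty X := inferInstance
  have hne : e (MulAut.conj (of a)) ≠ 1 := by
    rw [ne_eq, EmbeddingLike.map_eq_one_iff, ← _root_.map_one MulAut.conj, conj_injective.eq_iff]
    exact of_ne_one a
  let F : conjugatesOf (e (MulAut.conj (of a))) → conjugatesOf (MulAut.conj (of a)) :=
    fun ψ => ⟨e.symm ψ.1, by
      have : IsConj (e.symm (e (MulAut.conj (of a)))) (e.symm ψ.1) :=
        e.symm.toMonoidHom.map_isConj ψ.2
      rwa [e.symm_apply_apply] at this⟩
  have hF : Function.Injective F := fun ψ ψ' h =>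
    Subtype.ext (e.symm.injective (congrArg Subtype.val h))
  exact (Cardinal.lift_le.mpr (mk_le_mk_conjugatesOf hne)).trans
    ((Cardinal.lift_mk_le_lift_mk_of_injective hF).trans
      (Cardinal.lift_le.mpr (mk_conjugatesOf_conj_le (of a))))

end InfiniteRank

end FreeGroup

/-- Two non-abelian free groups with isomorphic automorphism groups are
isomorphic. -/
theorem free_group_iso_of_aut_iso (X X' : Type*)
    (a b : X) (hab : a ≠ b) (a' b' : X') (hab' : a' ≠ b')
    (h : Nonempty (MulAut (FreeGroup X) ≃* MulAut (FreeGroup X'))) :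
    Nonempty (FreeGroup X ≃* FreeGroup X') := by
  obtain ⟨e⟩ := h
  suffices Nonempty (X ≃ X') from this.map FreeGroup.freeGroupCongr
  rcases finite_or_infinite X with hX | hX
  · obtain ⟨hX', hle⟩ := FreeGroup.finite_and_card_le_of_mulAut_equiv e.symm
    obtain ⟨-, hle'⟩ := FreeGroup.finite_and_card_le_of_mulAut_equiv e
    exact Finite.card_eq.mp (hle'.antisymm hle)
  · rcases finite_or_infinite X' with hX' | hX'
    · exact absurd (FreeGroup.finite_and_card_le_of_mulAut_equiv e).1 (not_finite_iff_infinite.mpr hX)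
    · exact Cardinal.lift_mk_eq'.mp ((FreeGroup.lift_mk_le_of_mulAut_equiv e.symm).antisymm
        (FreeGroup.lift_mk_le_of_mulAut_equiv e))
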